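/- arXiv:2302.06636 — 3 statements merged into one kernel-verified Lean document; each statement's English description precedes it below -/
import Mathlib

section
/- There exists a constant C>0 such that for every a∈[0,1], every admissible frequency triple (ω,m,Λ) with m≠0, and every r≥2: |V(r) − Λ r⁻²| ≤ C Λ r⁻³ and |dV/dr(r) + 2Λ r⁻³| ≤ C Λ r⁻⁴. (This is the uniform far-field expansion V(r)=Λ(r⁻²+O₁(r⁻³)) of Lemma 5.1, equation (eq:Vnearinf).) -/
noncomputable section

/-- Normalized (horizon radius `r₊ = 1`) `Δ(r) = (r−1)(r−a²)`. -/
def kDelta (a r : ℝ) : ℝ := (r - 1) * (r - a ^ 2)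

/-- `V₀(r) = (r²+a²)⁻²(2ma(1+a²)ωr − a²m² + ΛΔ(r))`. -/
def V0 (a : ℝ) (m : ℤ) (ω Λ r : ℝ) : ℝ :=
  ((r ^ 2 + a ^ 2)⁻¹) ^ 2 *
    (2 * (m : ℝ) * a * (1 + a ^ 2) * ω * r - a ^ 2 * (m : ℝ) ^ 2 + Λ * kDelta a r)

/-- `V₁(r) = (r²+a²)⁻³Δ(r)(3r²−2(1+a²)r+a²) − 3(r²+a²)⁻⁴Δ(r)²r²`. -/
def V1 (a r : ℝ) : ℝ :=
  ((r ^ 2 + a ^ 2)⁻¹) ^ 3 * kDelta a r * (3 * r ^ 2 - 2 * (1 + a ^ 2) * r + a ^ 2)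
    - 3 * ((r ^ 2 + a ^ 2)⁻¹) ^ 4 * kDelta a r ^ 2 * r ^ 2

/-- `V = V₀ + V₁`. -/
def Vpot (a : ℝ) (m : ℤ) (ω Λ r : ℝ) : ℝ := V0 a m ω Λ r + V1 a r

/-- A frequency triple `(ω, m, Λ)` is admissible iff `Λ ≥ max{|m|(|m|+1), 2|mω|}`. -/
def Admissible (m : ℤ) (ω Λ : ℝ) : Prop :=
  max (|(m : ℝ)| * (|(m : ℝ)| + 1)) (2 * |(m : ℝ) * ω|) ≤ Λ

/-- Numerator of the `Λ`-dependent remainder `V₀ − Λr⁻²` over the denominator `r²(r²+a²)²`. -/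
def remainderNum (a A B Λ r : ℝ) : ℝ :=
  (A - Λ * (1 + a ^ 2)) * r ^ 3 - (B + Λ * a ^ 2) * r ^ 2 - Λ * a ^ 4

/-- The cubic factor of `V₁` left after the cancellation of its leading terms. -/
def V1Cubic (a r : ℝ) : ℝ :=
  (1 + a ^ 2) * r ^ 3 + a ^ 2 * r ^ 2 - 2 * a ^ 2 * (1 + a ^ 2) * r + a ^ 4

lemma Vpot_eq (a : ℝ) (m : ℤ) (ω Λ : ℝ) {r : ℝ} (hr : r ≠ 0) :
    Vpot a m ω Λ r = Λ * (r ^ 2)⁻¹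
      + remainderNum a (2 * m * a * (1 + a ^ 2) * ω) (a ^ 2 * m ^ 2) Λ r
        / (r ^ 2 * (r ^ 2 + a ^ 2) ^ 2)
      + kDelta a r * V1Cubic a r / (r ^ 2 + a ^ 2) ^ 4 := by
  have hp : r ^ 2 + a ^ 2 ≠ 0 := by positivity
  unfold Vpot V0 V1 remainderNum V1Cubic kDelta
  field_simp
  ring

lemma hasDerivAt_remainderNum (a A B Λ r : ℝ) :
    HasDerivAt (remainderNum a A B Λ)
      (3 * (A - Λ * (1 + a ^ 2)) * r ^ 2 - 2 * (B + Λ * a ^ 2) * r) r := by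
  refine ((((hasDerivAt_pow 3 r).const_mul (A - Λ * (1 + a ^ 2))).fun_sub
    ((hasDerivAt_pow 2 r).const_mul (B + Λ * a ^ 2))).sub_const (Λ * a ^ 4)).congr_deriv ?_
  norm_num
  ring

lemma hasDerivAt_V1Cubic (a r : ℝ) :
    HasDerivAt (V1Cubic a)
      (3 * (1 + a ^ 2) * r ^ 2 + 2 * a ^ 2 * r - 2 * a ^ 2 * (1 + a ^ 2)) r := by
  refine (((((hasDerivAt_pow 3 r).const_mul (1 + a ^ 2)).fun_add
    ((hasDerivAt_pow 2 r).const_mul (a ^ 2))).fun_sub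
    ((hasDerivAt_id' r).const_mul (2 * a ^ 2 * (1 + a ^ 2)))).add_const (a ^ 4)).congr_deriv ?_
  norm_num
  ring

lemma hasDerivAt_kDelta (a r : ℝ) : HasDerivAt (kDelta a) (2 * r - (1 + a ^ 2)) r := by
  refine (((hasDerivAt_id' r).sub_const 1).fun_mul
    ((hasDerivAt_id' r).sub_const (a ^ 2))).congr_deriv ?_
  ring

lemma hasDerivAt_sq_add_sq (a r : ℝ) : HasDerivAt (fun x => x ^ 2 + a ^ 2) (2 * r) r := by
  simpa using (hasDerivAt_pow 2 r).add_const (a ^ 2)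

lemma hasDerivAt_inverse_square_expansion {E F : ℝ → ℝ} {E' F' a Λ r : ℝ} (hr : r ≠ 0)
    (hE : HasDerivAt E E' r) (hF : HasDerivAt F F' r) :
    HasDerivAt
      (fun x => Λ * (x ^ 2)⁻¹ + E x / (x ^ 2 * (x ^ 2 + a ^ 2) ^ 2) + F x / (x ^ 2 + a ^ 2) ^ 4)
      (-(2 * Λ * (r ^ 3)⁻¹)
        + (E' * r * (r ^ 2 + a ^ 2) - E r * (2 * (r ^ 2 + a ^ 2) + 4 * r ^ 2))
          / (r ^ 3 * (r ^ 2 + a ^ 2) ^ 3)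
        + (F' * (r ^ 2 + a ^ 2) - 8 * r * F r) / (r ^ 2 + a ^ 2) ^ 5) r := by
  have hp : r ^ 2 + a ^ 2 ≠ 0 := by positivity
  have h2 := hasDerivAt_pow 2 r
  have hP := hasDerivAt_sq_add_sq a r
  refine ((((h2.fun_inv (by positivity)).const_mul Λ).fun_add
    (hE.fun_div (h2.fun_mul (hP.fun_pow 2)) (by positivity))).fun_add
    (hF.fun_div (hP.fun_pow 4) (by positivity))).congr_deriv ?_
  push_cast
  field_simp
  ring

lemma abs_div_le_mul_inv_pow {X D K r : ℝ} {k n : ℕ} (hr : 0 < r) (hX : |X| ≤ K * r ^ k)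
    (hD : r ^ (k + n) ≤ D) : |X / D| ≤ K * (r ^ n)⁻¹ := by
  have hD0 : 0 < D := (pow_pos hr _).trans_le hD
  have hK : 0 ≤ K := nonneg_of_mul_nonneg_left ((abs_nonneg X).trans hX) (pow_pos hr k)
  rw [abs_div, abs_of_pos hD0, div_le_iff₀ hD0]
  calc |X| ≤ K * r ^ k := hX
    _ = K * (r ^ n)⁻¹ * r ^ (k + n) := by rw [pow_add]; field_simp
    _ ≤ K * (r ^ n)⁻¹ * D := by gcongr

section Bounds

variable {a r : ℝ}

lemma abs_kDelta_le (ha0 : 0 ≤ a) (ha1 : a ≤ 1) (hr : 1 ≤ r) : |kDelta a r| ≤ r ^ 2 := by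
  have h : a ^ 2 ≤ 1 := pow_le_one₀ ha0 ha1
  have h' := sq_nonneg a
  unfold kDelta
  rw [abs_of_nonneg (mul_nonneg (by linarith) (by linarith)), sq r]
  exact mul_le_mul (by linarith) (by linarith) (by linarith) (by linarith)

lemma abs_deriv_kDelta_le (ha0 : 0 ≤ a) (ha1 : a ≤ 1) (hr : 1 ≤ r) :
    |2 * r - (1 + a ^ 2)| ≤ 2 * r := by
  have h : a ^ 2 ≤ 1 := pow_le_one₀ ha0 ha1
  have h' := sq_nonneg a
  rw [abs_le]
  constructor <;> linarith

lemma abs_V1Cubic_le (ha0 : 0 ≤ a) (ha1 : a ≤ 1) (hr : 1 ≤ r) : |V1Cubic a r| ≤ 8 * r ^ 3 := by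
  have h : a ^ 2 ≤ 1 := pow_le_one₀ ha0 ha1
  have h4 : a ^ 4 ≤ 1 := pow_le_one₀ ha0 ha1
  have e0 : 1 ≤ r ^ 3 := one_le_pow₀ hr
  have e1 : r ≤ r ^ 3 := le_self_pow₀ hr (by norm_num)
  have e2 : r ^ 2 ≤ r ^ 3 := pow_le_pow_right₀ hr (by norm_num)
  have t1 : (1 + a ^ 2) * r ^ 3 ≤ 2 * r ^ 3 := by gcongr; linarith
  have t2 : a ^ 2 * r ^ 2 ≤ 1 * r ^ 2 := by gcongr
  have t3 : 2 * a ^ 2 * (1 + a ^ 2) * r ≤ 2 * 1 * (1 + 1) * r := by gcongr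
  have p1 : 0 ≤ (1 + a ^ 2) * r ^ 3 := by positivity
  have p2 : 0 ≤ a ^ 2 * r ^ 2 := by positivity
  have p3 : 0 ≤ 2 * a ^ 2 * (1 + a ^ 2) * r := by positivity
  have p4 : 0 ≤ a ^ 4 := by positivity
  unfold V1Cubic
  rw [abs_le]
  constructor <;> linarith

lemma abs_deriv_V1Cubic_le (ha0 : 0 ≤ a) (ha1 : a ≤ 1) (hr : 1 ≤ r) :
    |3 * (1 + a ^ 2) * r ^ 2 + 2 * a ^ 2 * r - 2 * a ^ 2 * (1 + a ^ 2)| ≤ 12 * r ^ 2 := by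
  have h : a ^ 2 ≤ 1 := pow_le_one₀ ha0 ha1
  have e0 : 1 ≤ r ^ 2 := one_le_pow₀ hr
  have e1 : r ≤ r ^ 2 := le_self_pow₀ hr (by norm_num)
  have t1 : 3 * (1 + a ^ 2) * r ^ 2 ≤ 3 * (1 + 1) * r ^ 2 := by gcongr
  have t2 : 2 * a ^ 2 * r ≤ 2 * 1 * r := by gcongr
  have t3 : 2 * a ^ 2 * (1 + a ^ 2) ≤ 2 * 1 * (1 + 1) := by gcongr
  have p1 : 0 ≤ 3 * (1 + a ^ 2) * r ^ 2 := by positivity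
  have p2 : 0 ≤ 2 * a ^ 2 * r := by positivity
  have p3 : 0 ≤ 2 * a ^ 2 * (1 + a ^ 2) := by positivity
  rw [abs_le]
  constructor <;> linarith

variable {A B Λ : ℝ}

lemma abs_leadingCoeff_le (ha0 : 0 ≤ a) (ha1 : a ≤ 1) (hΛ : 0 ≤ Λ) (hA : |A| ≤ 2 * Λ) :
    |A - Λ * (1 + a ^ 2)| ≤ 4 * Λ := by
  have t : Λ * (1 + a ^ 2) ≤ Λ * (1 + 1) := by gcongr; exact pow_le_one₀ ha0 ha1
  have p : 0 ≤ Λ * (1 + a ^ 2) := by positivity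
  rw [abs_le] at hA ⊢
  constructor <;> linarith [hA.1, hA.2]

lemma abs_quadraticCoeff_le (ha0 : 0 ≤ a) (ha1 : a ≤ 1) (hΛ : 0 ≤ Λ) (hB : |B| ≤ Λ) :
    |B + Λ * a ^ 2| ≤ 2 * Λ := by
  have t : Λ * a ^ 2 ≤ Λ * 1 := by gcongr; exact pow_le_one₀ ha0 ha1
  have p : 0 ≤ Λ * a ^ 2 := by positivity
  rw [abs_le] at hB ⊢
  constructor <;> linarith [hB.1, hB.2]

lemma abs_remainderNum_le (ha0 : 0 ≤ a) (ha1 : a ≤ 1) (hr : 1 ≤ r) (hΛ : 0 ≤ Λ)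
    (hA : |A| ≤ 2 * Λ) (hB : |B| ≤ Λ) : |remainderNum a A B Λ r| ≤ 7 * Λ * r ^ 3 := by
  have hc : |Λ * a ^ 4| ≤ Λ * 1 := by
    rw [abs_of_nonneg (by positivity)]
    gcongr
    exact pow_le_one₀ ha0 ha1
  calc |remainderNum a A B Λ r|
      ≤ |(A - Λ * (1 + a ^ 2)) * r ^ 3| + |(B + Λ * a ^ 2) * r ^ 2| + |Λ * a ^ 4| :=
        (abs_sub _ _).trans (by gcongr; exact abs_sub _ _)
    _ = |A - Λ * (1 + a ^ 2)| * r ^ 3 + |B + Λ * a ^ 2| * r ^ 2 + |Λ * a ^ 4| := by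
        rw [abs_mul, abs_mul, abs_of_nonneg (by positivity : 0 ≤ r ^ 3),
          abs_of_nonneg (by positivity : 0 ≤ r ^ 2)]
    _ ≤ 4 * Λ * r ^ 3 + 2 * Λ * r ^ 3 + Λ * r ^ 3 := by
        gcongr
        · exact abs_leadingCoeff_le ha0 ha1 hΛ hA
        · exact abs_quadraticCoeff_le ha0 ha1 hΛ hB
        · norm_num
        · exact hc.trans (by gcongr; exact one_le_pow₀ hr)
    _ = 7 * Λ * r ^ 3 := by ring

lemma abs_deriv_remainderNum_le (ha0 : 0 ≤ a) (ha1 : a ≤ 1) (hr : 1 ≤ r) (hΛ : 0 ≤ Λ)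
    (hA : |A| ≤ 2 * Λ) (hB : |B| ≤ Λ) :
    |3 * (A - Λ * (1 + a ^ 2)) * r ^ 2 - 2 * (B + Λ * a ^ 2) * r| ≤ 16 * Λ * r ^ 2 := by
  calc |3 * (A - Λ * (1 + a ^ 2)) * r ^ 2 - 2 * (B + Λ * a ^ 2) * r|
      ≤ |3 * (A - Λ * (1 + a ^ 2)) * r ^ 2| + |2 * (B + Λ * a ^ 2) * r| := abs_sub _ _
    _ = 3 * |A - Λ * (1 + a ^ 2)| * r ^ 2 + 2 * |B + Λ * a ^ 2| * r := by
        simp only [abs_mul, abs_pow, abs_of_pos (zero_lt_one.trans_le hr), Nat.abs_ofNat]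
    _ ≤ 3 * (4 * Λ) * r ^ 2 + 2 * (2 * Λ) * r ^ 2 := by
        gcongr
        · exact abs_leadingCoeff_le ha0 ha1 hΛ hA
        · exact abs_quadraticCoeff_le ha0 ha1 hΛ hB
        · exact le_self_pow₀ hr (by norm_num)
    _ = 16 * Λ * r ^ 2 := by ring

end Bounds

lemma Admissible.one_le {m : ℤ} {ω Λ : ℝ} (h : Admissible m ω Λ) (hm : m ≠ 0) : 1 ≤ Λ := by
  have h1 : (1 : ℝ) ≤ |(m : ℝ)| := by exact_mod_cast Int.one_le_abs hm
  nlinarith [(le_max_left _ _).trans h]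

lemma Admissible.abs_linear_le {m : ℤ} {ω Λ a : ℝ} (h : Admissible m ω Λ) (ha0 : 0 ≤ a)
    (ha1 : a ≤ 1) : |2 * m * a * (1 + a ^ 2) * ω| ≤ 2 * Λ := by
  have h2 : 2 * |(m : ℝ) * ω| ≤ Λ := (le_max_right _ _).trans h
  calc |2 * m * a * (1 + a ^ 2) * ω| = a * (1 + a ^ 2) * (2 * |(m : ℝ) * ω|) := by
        rw [show 2 * m * a * (1 + a ^ 2) * ω = a * (1 + a ^ 2) * (2 * (m * ω)) by ring, abs_mul,
          abs_of_nonneg (by positivity : 0 ≤ a * (1 + a ^ 2)), abs_mul 2, Nat.abs_ofNat]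
    _ ≤ 1 * (1 + 1) * Λ := by
        gcongr
        exact pow_le_one₀ ha0 ha1
    _ = 2 * Λ := by ring

lemma Admissible.abs_const_le {m : ℤ} {ω Λ a : ℝ} (h : Admissible m ω Λ) (ha0 : 0 ≤ a)
    (ha1 : a ≤ 1) : |a ^ 2 * (m : ℝ) ^ 2| ≤ Λ := by
  have h1 : |(m : ℝ)| * (|(m : ℝ)| + 1) ≤ Λ := (le_max_left _ _).trans h
  have h2 : (m : ℝ) ^ 2 ≤ Λ := by nlinarith [sq_abs (m : ℝ), abs_nonneg (m : ℝ)]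
  rw [abs_of_nonneg (by positivity)]
  exact (mul_le_of_le_one_left (by positivity) (pow_le_one₀ ha0 ha1)).trans h2

/-- eq:Vnearinf of Lemma 5.1: uniform far-field expansion
`V(r) = Λ(r⁻² + O₁(r⁻³))`: there is `C > 0` such that for all `a ∈ [0,1]`, all admissible
`(ω,m,Λ)` with `m ≠ 0`, and all `r ≥ 2`, `|V(r) − Λr⁻²| ≤ CΛr⁻³` and
`|V′(r) + 2Λr⁻³| ≤ CΛr⁻⁴`. -/
theorem V_far_field_expansion :
    ∃ C > 0, ∀ a ∈ Set.Icc (0 : ℝ) 1, ∀ m : ℤ, m ≠ 0 → ∀ ω Λ : ℝ, Admissible m ω Λ →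
      ∀ r : ℝ, 2 ≤ r →
        |Vpot a m ω Λ r - Λ * (r ^ 2)⁻¹| ≤ C * Λ * (r ^ 3)⁻¹ ∧
        |deriv (Vpot a m ω Λ) r + 2 * Λ * (r ^ 3)⁻¹| ≤ C * Λ * (r ^ 4)⁻¹ := by
  refine ⟨208, by norm_num, ?_⟩
  rintro a ⟨ha0, ha1⟩ m hm ω Λ hadm r hr2
  have hr : 1 ≤ r := by linarith
  have hr0 : 0 < r := by linarith
  have hΛ1 : 1 ≤ Λ := hadm.one_le hm
  have hΛ : 0 ≤ Λ := by linarith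
  have hA := hadm.abs_linear_le ha0 ha1
  have hB := hadm.abs_const_le ha0 ha1
  set A : ℝ := 2 * m * a * (1 + a ^ 2) * ω
  set B : ℝ := a ^ 2 * m ^ 2
  have hV : ∀ x : ℝ, x ≠ 0 → Vpot a m ω Λ x = Λ * (x ^ 2)⁻¹
      + remainderNum a A B Λ x / (x ^ 2 * (x ^ 2 + a ^ 2) ^ 2)
      + kDelta a x * V1Cubic a x / (x ^ 2 + a ^ 2) ^ 4 := fun x hx => Vpot_eq a m ω Λ hx
  have hE := abs_remainderNum_le ha0 ha1 hr hΛ hA hB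
  have hE' := abs_deriv_remainderNum_le ha0 ha1 hr hΛ hA hB
  have hΔ := abs_kDelta_le ha0 ha1 hr
  have hG := abs_V1Cubic_le ha0 ha1 hr
  have hF : |kDelta a r * V1Cubic a r| ≤ 8 * r ^ 5 := by
    rw [abs_mul]
    calc _ ≤ r ^ 2 * (8 * r ^ 3) := by gcongr
      _ = 8 * r ^ 5 := by ring
  have hp : r ^ 2 ≤ r ^ 2 + a ^ 2 := by linarith [sq_nonneg a]
  have hp0 : 0 < r ^ 2 + a ^ 2 := by positivity
  have hp2 : r ^ 2 + a ^ 2 ≤ 2 * r ^ 2 := by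
    have : a ^ 2 ≤ r ^ 2 := by gcongr; linarith
    linarith
  have hdV := (hasDerivAt_inverse_square_expansion (a := a) (Λ := Λ) hr0.ne'
    (hasDerivAt_remainderNum a A B Λ r)
    ((hasDerivAt_kDelta a r).fun_mul (hasDerivAt_V1Cubic a r))).congr_of_eventuallyEq
    (f₁ := Vpot a m ω Λ) ((eventually_ne_nhds hr0.ne').mono hV)
  rw [hV r hr0.ne', hdV.deriv]
  have hF' : |(2 * r - (1 + a ^ 2)) * V1Cubic a r + kDelta a r *
      (3 * (1 + a ^ 2) * r ^ 2 + 2 * a ^ 2 * r - 2 * a ^ 2 * (1 + a ^ 2))| ≤ 28 * r ^ 4 := by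
    refine (abs_add_le _ _).trans ?_
    rw [abs_mul, abs_mul]
    calc _ ≤ 2 * r * (8 * r ^ 3) + r ^ 2 * (12 * r ^ 2) := by
          gcongr
          · exact abs_deriv_kDelta_le ha0 ha1 hr
          · exact abs_deriv_V1Cubic_le ha0 ha1 hr
      _ = 28 * r ^ 4 := by ring
  set E := remainderNum a A B Λ r
  set E' := 3 * (A - Λ * (1 + a ^ 2)) * r ^ 2 - 2 * (B + Λ * a ^ 2) * r
  set F := kDelta a r * V1Cubic a r
  set F' := (2 * r - (1 + a ^ 2)) * V1Cubic a r + kDelta a r *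
      (3 * (1 + a ^ 2) * r ^ 2 + 2 * a ^ 2 * r - 2 * a ^ 2 * (1 + a ^ 2))
  set p := r ^ 2 + a ^ 2
  constructor
  · have b1 : |E / (r ^ 2 * p ^ 2)| ≤ 7 * Λ * (r ^ 3)⁻¹ := by
      refine abs_div_le_mul_inv_pow hr0 hE ?_
      calc r ^ (3 + 3) = r ^ 2 * (r ^ 2) ^ 2 := by ring
        _ ≤ r ^ 2 * p ^ 2 := by gcongr
    have b2 : |F / p ^ 4| ≤ 8 * (r ^ 3)⁻¹ := by
      refine abs_div_le_mul_inv_pow hr0 hF ?_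
      calc r ^ (5 + 3) = (r ^ 2) ^ 4 := by ring
        _ ≤ p ^ 4 := by gcongr
    calc _ = |E / (r ^ 2 * p ^ 2) + F / p ^ 4| := by ring_nf
      _ ≤ 7 * Λ * (r ^ 3)⁻¹ + 8 * (r ^ 3)⁻¹ := (abs_add_le _ _).trans (add_le_add b1 b2)
      _ = (7 * Λ + 8) * (r ^ 3)⁻¹ := by ring
      _ ≤ 208 * Λ * (r ^ 3)⁻¹ := by gcongr; linarith
  · have b1 : |(E' * r * p - E * (2 * p + 4 * r ^ 2)) / (r ^ 3 * p ^ 3)|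
        ≤ 88 * Λ * (r ^ 4)⁻¹ := by
      refine abs_div_le_mul_inv_pow (k := 5) hr0 ?_ ?_
      · refine (abs_sub _ _).trans ?_
        rw [abs_mul, abs_mul, abs_mul, abs_of_pos hr0, abs_of_pos hp0,
          abs_of_pos (by positivity : 0 < 2 * p + 4 * r ^ 2)]
        calc _ ≤ 16 * Λ * r ^ 2 * r * (2 * r ^ 2)
              + 7 * Λ * r ^ 3 * (2 * (2 * r ^ 2) + 4 * r ^ 2) := by gcongr
          _ = 88 * Λ * r ^ 5 := by ring
      · calc r ^ (5 + 4) = r ^ 3 * (r ^ 2) ^ 3 := by ring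
          _ ≤ r ^ 3 * p ^ 3 := by gcongr
    have b2 : |(F' * p - 8 * r * F) / p ^ 5| ≤ 120 * (r ^ 4)⁻¹ := by
      refine abs_div_le_mul_inv_pow (k := 6) hr0 ?_ ?_
      · refine (abs_sub _ _).trans ?_
        rw [abs_mul, abs_mul, abs_of_pos hp0, abs_of_pos (by positivity : 0 < 8 * r)]
        calc _ ≤ 28 * r ^ 4 * (2 * r ^ 2) + 8 * r * (8 * r ^ 5) := by gcongr
          _ = 120 * r ^ 6 := by ring
      · calc r ^ (6 + 4) = (r ^ 2) ^ 5 := by ring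
          _ ≤ p ^ 5 := by gcongr
    calc _ = |(E' * r * p - E * (2 * p + 4 * r ^ 2)) / (r ^ 3 * p ^ 3)
          + (F' * p - 8 * r * F) / p ^ 5| := by ring_nf
      _ ≤ 88 * Λ * (r ^ 4)⁻¹ + 120 * (r ^ 4)⁻¹ := (abs_add_le _ _).trans (add_le_add b1 b2)
      _ = (88 * Λ + 120) * (r ^ 4)⁻¹ := by ring
      _ ≤ 208 * Λ * (r ^ 4)⁻¹ := by gcongr; linarith
end
end

section
/- There exists a constant C>0 such that for every a∈[0,1], every admissible frequency triple (ω,m,Λ) with m≠0, and every r∈[1,2]: | Ṽ₀(r) − c₁·(r−1) − c₂·(r−1)² | ≤ C Λ (r−1)³, where c₁ = (1+a²)⁻³[ −8amω̃ + 2(Λ−m²)(1−a²) + (2m²−Λ+2amω̃)(1−a²)² ] and c₂ = (1+a²)⁻⁴[ 4(Λ−2m²) + 6(3m²−2Λ+4amω̃)(1−a²) + (5Λ−10m²−12amω̃)(1−a²)² ]. (This is the near-horizon expansion (eq:V0nearhor) of Lemma 5.1; in particular Ṽ₀(1)=0, and at a=1 the expansion reads Ṽ₀(r) = −mω̃(r−1)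 + ¼(Λ−2m²)(r−1)² + O(Λ(r−1)³).) -/
noncomputable section

/-- `ω̃ = ω − mω₊` with `ω₊ = a/(1+a²)`. -/
def omegaTilde (a : ℝ) (m : ℤ) (ω : ℝ) : ℝ := ω - (m : ℝ) * (a / (1 + a ^ 2))

/-- The shifted potential `Ṽ₀ = V₀ − ω² + ω̃²`. -/
def V0t (a : ℝ) (m : ℤ) (ω Λ r : ℝ) : ℝ :=
  V0 a m ω Λ r - ω ^ 2 + omegaTilde a m ω ^ 2

/-- Exact remainder of the second order Taylor expansion at `x = 0` of
`(p₀ + p₁ x + p₂ x²) / (b + 2x + x²)²`. -/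
lemma taylor_remainder_eq {b x : ℝ} (hb : 0 < b) (hx : 0 ≤ x) (p₀ p₁ p₂ : ℝ) :
    ((b + 2 * x + x ^ 2)⁻¹) ^ 2 * (p₀ + p₁ * x + p₂ * x ^ 2) - (b⁻¹) ^ 2 * p₀
      - (b⁻¹) ^ 3 * (b * p₁ - 4 * p₀) * x
      - (b⁻¹) ^ 4 * (b ^ 2 * p₂ - 4 * b * p₁ + (12 - 2 * b) * p₀) * x ^ 2
    = (b⁻¹) ^ 4 * ((b + 2 * x + x ^ 2)⁻¹) ^ 2 *
      (b * p₁ * (12 * b - 2 * b ^ 2 + (16 + 4 * b) * x + (16 - b) * x ^ 2 + 4 * x ^ 3)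
        - p₀ * (32 * b - 12 * b ^ 2 + (48 - 3 * b ^ 2) * x + (48 - 12 * b) * x ^ 2
          + (12 - 2 * b) * x ^ 3)
        - p₂ * (b ^ 2 * (2 + x) * (2 * b + 2 * x + x ^ 2))) * x ^ 3 := by
  have hq : b + 2 * x + x ^ 2 ≠ 0 := by positivity
  field_simp
  ring

/-- Uniform bound for the remainder of the second order Taylor expansion at `x = 0` of
`(p₀ + p₁ x + p₂ x²) / (b + 2x + x²)²`. -/
lemma abs_taylor_remainder_le {b x L p₀ p₁ p₂ : ℝ} (hb₁ : 1 ≤ b) (hb₂ : b ≤ 2)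
    (hx₀ : 0 ≤ x) (hx₁ : x ≤ 1) (h₀ : |p₀| ≤ 3 * L) (h₁ : |p₁| ≤ 3 * L) (h₂ : |p₂| ≤ L) :
    |((b + 2 * x + x ^ 2)⁻¹) ^ 2 * (p₀ + p₁ * x + p₂ * x ^ 2) - (b⁻¹) ^ 2 * p₀
      - (b⁻¹) ^ 3 * (b * p₁ - 4 * p₀) * x
      - (b⁻¹) ^ 4 * (b ^ 2 * p₂ - 4 * b * p₁ + (12 - 2 * b) * p₀) * x ^ 2|
    ≤ 1500 * L * x ^ 3 := by
  have hb : 0 < b := by linarith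
  have hL : 0 ≤ L := (abs_nonneg _).trans h₂
  have hx2 : x ^ 2 ≤ 1 := pow_le_one₀ hx₀ hx₁
  have hx3 : x ^ 3 ≤ 1 := pow_le_one₀ hx₀ hx₁
  have hx2' : 0 ≤ x ^ 2 := by positivity
  have hx3' : 0 ≤ x ^ 3 := by positivity
  have hbb : b ^ 2 ≤ 4 := by nlinarith
  have hB : |12 * b - 2 * b ^ 2 + (16 + 4 * b) * x + (16 - b) * x ^ 2 + 4 * x ^ 3| ≤ 70 := by
    rw [abs_le]
    constructor <;> nlinarith [mul_nonneg hb.le hx₀, mul_nonneg hb.le hx2',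
      mul_nonneg (sub_nonneg.2 hb₂) hx₀, mul_nonneg (sub_nonneg.2 hb₂) hx2']
  have hA : |32 * b - 12 * b ^ 2 + (48 - 3 * b ^ 2) * x + (48 - 12 * b) * x ^ 2
      + (12 - 2 * b) * x ^ 3| ≤ 200 := by
    rw [abs_le]
    constructor <;> nlinarith [mul_nonneg hb.le hx2', mul_nonneg hb.le hx3',
      mul_nonneg (sub_nonneg.2 hb₂) hx2', mul_nonneg (sub_nonneg.2 hb₂) hx3',
      mul_nonneg (sub_nonneg.2 hbb) hx₀, mul_nonneg (sq_nonneg b) hx₀]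
  have hG : |b ^ 2 * (2 + x) * (2 * b + 2 * x + x ^ 2)| ≤ 84 := by
    rw [abs_of_nonneg (by positivity)]
    calc b ^ 2 * (2 + x) * (2 * b + 2 * x + x ^ 2)
        ≤ 4 * (2 + 1) * (2 * 2 + 2 * 1 + 1) := by gcongr
      _ = 84 := by norm_num
  have hw : (b⁻¹) ^ 4 * ((b + 2 * x + x ^ 2)⁻¹) ^ 2 ≤ 1 := by
    have h₃ : b⁻¹ ≤ 1 := inv_le_one_of_one_le₀ hb₁
    have h₄ : (b + 2 * x + x ^ 2)⁻¹ ≤ 1 := inv_le_one_of_one_le₀ (by linarith)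
    exact mul_le_one₀ (pow_le_one₀ (by positivity) h₃) (by positivity)
      (pow_le_one₀ (by positivity) h₄)
  rw [taylor_remainder_eq hb hx₀, abs_mul, abs_mul, abs_of_nonneg hx3',
    abs_of_nonneg (show 0 ≤ (b⁻¹) ^ 4 * ((b + 2 * x + x ^ 2)⁻¹) ^ 2 by positivity)]
  refine mul_le_mul_of_nonneg_right ?_ hx3'
  refine (mul_le_of_le_one_left (abs_nonneg _) hw).trans ?_
  refine (abs_sub _ _).trans ((add_le_add_left (abs_sub _ _) _).trans ?_)
  rw [abs_mul, abs_mul, abs_mul p₀, abs_mul p₂, abs_of_pos hb]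
  have e₁ := mul_le_mul (mul_le_mul hb₂ h₁ (abs_nonneg _) zero_le_two) hB (abs_nonneg _)
    (by positivity)
  have e₀ := mul_le_mul h₀ hA (abs_nonneg _) (by positivity)
  have e₂ := mul_le_mul h₂ hG (abs_nonneg _) hL
  linarith

/-- eq:V0nearhor of Lemma 5.1: there is `C > 0` such that for all
`a ∈ [0,1]`, admissible `(ω,m,Λ)` with `m ≠ 0`, and `r ∈ [1,2]`,
`|Ṽ₀(r) − c₁(r−1) − c₂(r−1)²| ≤ CΛ(r−1)³` with
`c₁ = (1+a²)⁻³[−8amω̃ + 2(Λ−m²)(1−a²) + (2m²−Λ+2amω̃)(1−a²)²]` and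
`c₂ = (1+a²)⁻⁴[4(Λ−2m²) + 6(3m²−2Λ+4amω̃)(1−a²) + (5Λ−10m²−12amω̃)(1−a²)²]`;
in particular `Ṽ₀(1) = 0`. -/
theorem V0t_near_horizon_expansion :
    ∃ C > 0, ∀ a ∈ Set.Icc (0 : ℝ) 1, ∀ m : ℤ, m ≠ 0 → ∀ ω Λ : ℝ, Admissible m ω Λ →
      V0t a m ω Λ 1 = 0 ∧
      ∀ r ∈ Set.Icc (1 : ℝ) 2,
        |V0t a m ω Λ r
            - ((1 + a ^ 2)⁻¹) ^ 3 *
                (-8 * a * (m : ℝ) * omegaTilde a m ω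
                  + 2 * (Λ - (m : ℝ) ^ 2) * (1 - a ^ 2)
                  + (2 * (m : ℝ) ^ 2 - Λ + 2 * a * (m : ℝ) * omegaTilde a m ω)
                      * (1 - a ^ 2) ^ 2) * (r - 1)
            - ((1 + a ^ 2)⁻¹) ^ 4 *
                (4 * (Λ - 2 * (m : ℝ) ^ 2)
                  + 6 * (3 * (m : ℝ) ^ 2 - 2 * Λ + 4 * a * (m : ℝ) * omegaTilde a m ω)
                      * (1 - a ^ 2)
                  + (5 * Λ - 10 * (m : ℝ) ^ 2 - 12 * a * (m : ℝ) * omegaTilde a m ω)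
                      * (1 - a ^ 2) ^ 2) * (r - 1) ^ 2|
          ≤ C * Λ * (r - 1) ^ 3 := by
  refine ⟨1500, by norm_num, fun a ha m _ ω Λ hadm => ⟨?_, fun r hr => ?_⟩⟩
  · have hb : 1 + a ^ 2 ≠ 0 := by positivity
    simp only [V0t, V0, kDelta, omegaTilde, one_pow]
    field_simp
    ring
  obtain ⟨ha₀, ha₁⟩ := ha
  obtain ⟨hr₁, hr₂⟩ := hr
  obtain ⟨hm, hmω⟩ := max_le_iff.1 hadm
  have ha2 : a ^ 2 ≤ 1 := pow_le_one₀ ha₀ ha₁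
  have ha2' : 0 ≤ a ^ 2 := sq_nonneg a
  have hmΛ : (m : ℝ) ^ 2 ≤ Λ := by
    rw [← sq_abs]
    nlinarith [abs_nonneg (m : ℝ)]
  have hΛ : 0 ≤ Λ := (sq_nonneg _).trans hmΛ
  have hα : |2 * (m : ℝ) * a * (1 + a ^ 2) * ω| ≤ 2 * Λ := by
    have hfac : a * (1 + a ^ 2) ≤ 2 := by nlinarith
    calc |2 * (m : ℝ) * a * (1 + a ^ 2) * ω|
        = |a * (1 + a ^ 2) * (2 * ((m : ℝ) * ω))| := by ring_nf
      _ = a * (1 + a ^ 2) * (2 * |(m : ℝ) * ω|) := by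
        rw [abs_mul, abs_mul 2, abs_two, abs_of_nonneg (by positivity)]
      _ ≤ 2 * Λ := mul_le_mul hfac hmω (by positivity) zero_le_two
  have hβ : |a ^ 2 * (m : ℝ) ^ 2| ≤ Λ := by
    rw [abs_of_nonneg (by positivity)]
    exact (mul_le_of_le_one_left (sq_nonneg _) ha2).trans hmΛ
  have hΛs : |Λ * (1 - a ^ 2)| ≤ Λ := by
    rw [abs_of_nonneg (mul_nonneg hΛ (by linarith))]
    exact mul_le_of_le_one_right hΛ (by linarith)
  have hp₀ := (abs_sub (2 * (m : ℝ) * a * (1 + a ^ 2) * ω) (a ^ 2 * (m : ℝ) ^ 2)).trans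
    (show _ ≤ 3 * Λ by linarith)
  have hp₁ := (abs_add_le (2 * (m : ℝ) * a * (1 + a ^ 2) * ω) (Λ * (1 - a ^ 2))).trans
    (show _ ≤ 3 * Λ by linarith)
  have key := abs_taylor_remainder_le (b := 1 + a ^ 2) (x := r - 1) (by linarith)
    (by linarith) (by linarith) (by linarith) hp₀ hp₁ (abs_of_nonneg hΛ).le
  refine le_of_eq_of_le (congrArg _ ?_) key
  have hb : 1 + a ^ 2 ≠ 0 := by positivity
  have hq : 1 + a ^ 2 + 2 * (r - 1) + (r - 1) ^ 2 = r ^ 2 + a ^ 2 := by ring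
  rw [hq]
  have hN : 2 * (m : ℝ) * a * (1 + a ^ 2) * ω * r - a ^ 2 * (m : ℝ) ^ 2 + Λ * kDelta a r
      = 2 * (m : ℝ) * a * (1 + a ^ 2) * ω - a ^ 2 * (m : ℝ) ^ 2
        + (2 * (m : ℝ) * a * (1 + a ^ 2) * ω + Λ * (1 - a ^ 2)) * (r - 1)
        + Λ * (r - 1) ^ 2 := by
    rw [kDelta]
    ring
  rw [V0t, V0, hN]
  simp only [omegaTilde]
  generalize ((r ^ 2 + a ^ 2)⁻¹) ^ 2 * _ = Z
  field_simp
  ring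
end
end

section
/- Let a∈[0,1] and let (ω,m,Λ) be an admissible frequency triple with m(ω − mω₊) ≤ 0 (frequencies at or below the superradiant threshold). Then dV₀/dr(1) ≥ 0; equivalently, (r²+a²)³·dV₀/dr evaluated at r=1, which equals 2(1+a²)amω(a²−3) + 4m²a² + Λ(1−a⁴), is nonnegative. (This is part (iii) of Lemma 5.2: below the superradiant threshold the potential V₀ is nondecreasing at the horizon, so V₀ has no interior minimum there and exactly one critical point, a maximum.) -/
noncomputable section

theorem hasDerivAt_V0 (a : ℝ) (m : ℤ) (ω Λ : ℝ) {r : ℝ} (hr : r ^ 2 + a ^ 2 ≠ 0) :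
    HasDerivAt (V0 a m ω Λ)
      (((r ^ 2 + a ^ 2) * (2 * m * a * (1 + a ^ 2) * ω + Λ * (2 * r - 1 - a ^ 2))
        - 4 * r * (2 * m * a * (1 + a ^ 2) * ω * r - a ^ 2 * m ^ 2 + Λ * kDelta a r))
        / (r ^ 2 + a ^ 2) ^ 3) r := by
  have hx := hasDerivAt_id' r
  have hw := ((((hx.pow 2).add_const (a ^ 2)).inv hr).pow 2)
  have hΔ := (hx.sub_const 1).mul (hx.sub_const (a ^ 2))
  have hn := ((hx.const_mul (2 * (m : ℝ) * a * (1 + a ^ 2) * ω)).sub_const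
    (a ^ 2 * (m : ℝ) ^ 2)).add (hΔ.const_mul Λ)
  refine (hw.mul hn).congr_deriv ?_
  simp only [kDelta, Pi.add_apply, Pi.mul_apply, Pi.pow_apply, Pi.inv_apply,
    Nat.cast_ofNat, Nat.reduceSub, pow_one]
  field_simp
  ring

theorem Admissible.sq_le {m : ℤ} {ω Λ : ℝ} (h : Admissible m ω Λ) : (m : ℝ) ^ 2 ≤ Λ := by
  have h₁ := (le_max_left _ _).trans h
  nlinarith [abs_nonneg (m : ℝ), sq_abs (m : ℝ)]

/-- part (iii) of Lemma 5.2: for `a ∈ [0,1]` and admissible `(ω,m,Λ)`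
with `m(ω − mω₊) ≤ 0` (at or below the superradiant threshold, `ω₊ = a/(1+a²)`),
`dV₀/dr(1) ≥ 0`; equivalently `(r²+a²)³ dV₀/dr` at `r = 1`, which equals
`2(1+a²)amω(a²−3) + 4m²a² + Λ(1−a⁴)`, is nonnegative. -/
theorem V0_deriv_nonneg_at_horizon_below_threshold (a : ℝ) (ha : a ∈ Set.Icc (0 : ℝ) 1)
    (m : ℤ) (ω Λ : ℝ) (hadm : Admissible m ω Λ)
    (hsr : (m : ℝ) * (ω - (m : ℝ) * (a / (1 + a ^ 2))) ≤ 0) :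
    (1 + a ^ 2) ^ 3 * deriv (V0 a m ω Λ) 1
        = 2 * (1 + a ^ 2) * a * (m : ℝ) * ω * (a ^ 2 - 3)
          + 4 * (m : ℝ) ^ 2 * a ^ 2 + Λ * (1 - a ^ 4) ∧
    0 ≤ 2 * (1 + a ^ 2) * a * (m : ℝ) * ω * (a ^ 2 - 3)
          + 4 * (m : ℝ) ^ 2 * a ^ 2 + Λ * (1 - a ^ 4) ∧
    0 ≤ deriv (V0 a m ω Λ) 1 := by
  have hs : 0 < 1 + a ^ 2 := by positivity
  obtain ⟨ha₀, ha₁⟩ := ha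
  have hder : (1 + a ^ 2) ^ 3 * deriv (V0 a m ω Λ) 1
      = 2 * (1 + a ^ 2) * a * (m : ℝ) * ω * (a ^ 2 - 3)
        + 4 * (m : ℝ) ^ 2 * a ^ 2 + Λ * (1 - a ^ 4) := by
    rw [(hasDerivAt_V0 a m ω Λ (r := 1) (by positivity)).deriv, kDelta]
    field_simp
    ring
  have ha2 : a ^ 2 ≤ 1 := pow_le_one₀ ha₀ ha₁
  have hω : (1 + a ^ 2) * (m * ω) ≤ a * (m : ℝ) ^ 2 := by
    have h := mul_nonpos_of_nonneg_of_nonpos hs.le hsr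
    field_simp at h
    linarith
  have hpos : 0 ≤ 2 * (1 + a ^ 2) * a * (m : ℝ) * ω * (a ^ 2 - 3)
      + 4 * (m : ℝ) ^ 2 * a ^ 2 + Λ * (1 - a ^ 4) := by
    have h₁ := mul_le_mul_of_nonneg_left hω
      (mul_nonneg (mul_nonneg zero_le_two ha₀) (by linarith : 0 ≤ 3 - a ^ 2))
    have h₂ := mul_le_mul_of_nonneg_right hadm.sq_le
      (mul_nonneg hs.le (sub_nonneg.mpr ha2))
    linarith [sq_nonneg ((m : ℝ) * (1 - a ^ 2))]
  exact ⟨hder, hpos, nonneg_of_mul_nonneg_right (hder ▸ hpos) (by positivity)⟩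
end
end
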